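/- (Vekua-type characterization) Let D ⊆ ℝ^{p+2} be a domain invariant under the reflection of the (p+2)-th variable, and let f(𝐱) = F₁(𝐱') + ωF₂(𝐱') ∈ 𝒢𝒮¹(Ω_D) ∩ C¹(Ω_D). Then f is monogenic on Ω_D if and only if F₁, F₂ satisfy, for all 𝐱' ∈ D \ ℝ^{p+1}, the system: D_{𝐱_p}F₁(𝐱') − ∂_r F₂(𝐱') = ((q−1)/r) F₂(𝐱') and \overline{D}_{𝐱_p}F₂(𝐱') + ∂_r F₁(𝐱') = 0. -/

import Mathlib

/-!
Common framework for generalized partial-slice monogenic functions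
(Xu–Sabadini, "On the Fueter-Sce theorem for generalized partial-slice
monogenic functions").

The real Clifford algebra `ℝ_{p+q}` is formalized as the Mathlib Clifford
algebra of the negative-definite quadratic form on `ℝ^{p+q}`; since Mathlib
provides no canonical norm on it, all analytic statements are phrased for an
arbitrary normed real algebra `A` together with an `ℝ`-algebra isomorphism
`ξ : A ≃ₐ[ℝ] Cl (p+q)`.  A point of `ℝ^{p+q+1}` is a pair
`(𝐱_p, 𝐱_q) : (Fin (p+1) → ℝ) × EuclideanSpace ℝ (Fin q)`, and a point of a
slice `ℝ^{p+2}` is a pair `(𝐱_p, r)`.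
-/

noncomputable section

open Filter Topology MeasureTheory Metric
open scoped Nat RealInnerProductSpace

namespace GPS

/-- The negative definite quadratic form `-(x₁² + ⋯ + xₙ²)` on `ℝⁿ`. -/
def Qe (n : ℕ) : QuadraticForm ℝ (Fin n → ℝ) :=
  QuadraticMap.weightedSumSquares ℝ (fun _ : Fin n => (-1 : ℝ))

/-- The real Clifford algebra `ℝ_n`. -/
abbrev Cl (n : ℕ) : Type := CliffordAlgebra (Qe n)

/-- The generators `e_1, …, e_n` of `ℝ_n` (indexed by `Fin n`). -/
def e (n : ℕ) (i : Fin n) : Cl n := CliffordAlgebra.ι (Qe n) (Pi.single i 1)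

variable (p q : ℕ)

/-- `ℝ^{p+1}`, the "slice-axis" space. -/
abbrev Vp : Type := Fin (p + 1) → ℝ

/-- `ℝ^q`. -/
abbrev Vq : Type := EuclideanSpace ℝ (Fin q)

/-- `ℝ^{p+q+1} = ℝ^{p+1} ⊕ ℝ^q`. -/
abbrev V : Type := Vp p × Vq q

/-- `ℝ^{p+2}`, the parameter space `(𝐱_p, r)` of a slice. -/
abbrev Sl : Type := Vp p × ℝ

/-- The sphere `𝕊` of unit 1-vectors, described by their coordinate vectors
`(x_{p+1}, …, x_{p+q}) ∈ ℝ^q` with `∑ x_i² = 1`. -/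
def S : Set (Vq q) := {v | ∑ j, v j ^ 2 = 1}

/-- The point `𝐱_p + r ω` of `ℝ^{p+q+1}`. -/
def spt (v : Vq q) (z : Sl p) : V p q := (z.1, z.2 • v)

/-- The (parameterized) slice `Ω_ω` of a set `Ω ⊆ ℝ^{p+q+1}`. -/
def sliceSet (Ω : Set (V p q)) (v : Vq q) : Set (Sl p) := {z | spt p q v z ∈ Ω}

/-- `Ω₀* = {𝐱_p + 𝐱_q : 𝐱_p ∈ Ω₀, 𝐱_q ∈ ℝ^q}`. -/
def star0 (Ω₀ : Set (Vp p)) : Set (V p q) := {z | z.1 ∈ Ω₀}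

/-- The p-symmetric completion `Ω_D` of a set `D ⊆ ℝ^{p+2}`. -/
def completion (D : Set (Sl p)) : Set (V p q) :=
  {x | ∃ z ∈ D, ∃ v ∈ S q, x = spt p q v z}

/-- `D` is invariant under the reflection of the `(p+2)`-th variable. -/
def ReflInv (D : Set (Sl p)) : Prop := ∀ z ∈ D, ((z.1, -z.2) : Sl p) ∈ D

/-- A domain: a nonempty open connected set. -/
def IsDomain {E : Type*} [TopologicalSpace E] (s : Set E) : Prop :=
  IsOpen s ∧ IsConnected s

/-- A slice domain. -/
def IsSliceDomain (Ω : Set (V p q)) : Prop :=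
  IsDomain Ω ∧ (∃ x : Vp p, ((x, 0) : V p q) ∈ Ω) ∧
    ∀ v ∈ S q, IsDomain (sliceSet p q Ω v)

/-- Partial symmetry with respect to `ℝ^{p+1}`. -/
def IsPSymmetric (Ω : Set (V p q)) : Prop :=
  ∀ (x : Vp p) (r : ℝ), ∀ v ∈ S q, ∀ w ∈ S q,
    ((x, r • v) : V p q) ∈ Ω → ((x, r • w) : V p q) ∈ Ω

/-- A `d`-dimensional smooth submanifold of a real normed space. -/
def IsSmoothSubmanifoldDim {E : Type*} [NormedAddCommGroup E] [NormedSpace ℝ E]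
    (d : ℕ) (M : Set E) : Prop :=
  ∀ x ∈ M, ∃ U : Set E, IsOpen U ∧ x ∈ U ∧
    ∃ (ψ : (Fin d → ℝ) → E) (W : Set (Fin d → ℝ)), IsOpen W ∧
      ContDiffOn ℝ (⊤ : ℕ∞) ψ W ∧ Set.InjOn ψ W ∧
      (∀ y ∈ W, Function.Injective (fderivWithin ℝ ψ W y)) ∧
      M ∩ U = ψ '' W

variable {A : Type*} [NormedRing A] [NormedAlgebra ℝ A] (ξ : A ≃ₐ[ℝ] Cl (p + q))

/-- The generators `e_1, …, e_{p+q}` inside `A`. -/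
def gen (i : Fin (p + q)) : A := ξ.symm (e (p + q) i)

/-- The generators `e_{p+1}, …, e_{p+q}` (the "q-part"). -/
def eQ (j : Fin q) : A := gen p q ξ ⟨p + (j : ℕ), by have := j.isLt; omega⟩

/-- The generators `e_1, …, e_p` (the "p-part", without `e_0 = 1`). -/
def eP (i : Fin p) : A := gen p q ξ ⟨(i : ℕ), by have := i.isLt; omega⟩

/-- `e_0 = 1, e_1, …, e_p`: the paravector basis of `ℝ^{p+1}` inside `A`. -/
def εp (i : Fin (p + 1)) : A :=
  if h : (i : ℕ) = 0 then 1 else gen p q ξ ⟨(i : ℕ) - 1, by have := i.isLt; omega⟩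

/-- The 1-vector `∑ x_i e_{p+i} ∈ A` corresponding to `𝐱_q ∈ ℝ^q`;
for a unit `v` this is the imaginary unit `ω ∈ 𝕊`. -/
def ωCl (v : Vq q) : A := ∑ j, v j • eQ p q ξ j

/-- The paravector `x_0 + x_1 e_1 + ⋯ + x_p e_p ∈ A` of `𝐱_p ∈ ℝ^{p+1}`. -/
def clP (x : Vp p) : A := ∑ i, x i • εp p q ξ i

/-- The paravector of `𝐱 ∈ ℝ^{p+q+1}` in `A`. -/
def toCl (z : V p q) : A := clP p q ξ z.1 + ωCl p q ξ z.2

section SliceOperators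

variable {F' : Type*} [NormedAddCommGroup F'] [NormedSpace ℝ F']

/-- `∂_{x_i}` on functions on `ℝ^{p+2}`. -/
def pdSl (i : Fin (p + 1)) (F : Sl p → F') : Sl p → F' :=
  fun z => fderiv ℝ F z (Pi.single i 1, 0)

/-- `∂_r` on functions on `ℝ^{p+2}`. -/
def pdr (F : Sl p → F') : Sl p → F' := fun z => fderiv ℝ F z (0, 1)

/-- `∂_{x_i}` (first factor) on functions on `ℝ^{p+q+1}`. -/
def pdV1 (i : Fin (p + 1)) (f : V p q → F') : V p q → F' :=
  fun z => fderiv ℝ f z ((Pi.single i 1 : Vp p), 0)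

/-- `∂_{x_{p+j}}` (second factor) on functions on `ℝ^{p+q+1}`. -/
def pdV2 (j : Fin q) (f : V p q → F') : V p q → F' :=
  fun z => fderiv ℝ f z (0, EuclideanSpace.single j 1)

/-- `∂_{x_i}` on functions on `ℝ^{p+1}`. -/
def pdP (i : Fin (p + 1)) (g : Vp p → F') : Vp p → F' :=
  fun x => fderiv ℝ g x (Pi.single i 1)

/-- The Laplacian `Δ_{𝐱'} = Δ_{𝐱_p} + ∂_r²` on `ℝ^{p+2}`. -/
def LapSl (F : Sl p → F') : Sl p → F' :=
  fun z => ∑ i, pdSl p (i := i) (pdSl p i F) z + pdr p (pdr p F) z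

/-- The Laplacian `Δ_𝐱` on `ℝ^{p+q+1}`. -/
def LapV (f : V p q → F') : V p q → F' :=
  fun z => ∑ i, pdV1 p q i (pdV1 p q i f) z + ∑ j, pdV2 p q j (pdV2 p q j f) z

/-- The Laplacian `Δ_{𝐱_p}` on `ℝ^{p+1}`. -/
def LapP (g : Vp p → F') : Vp p → F' :=
  fun x => ∑ i, pdP p i (pdP p i g) x

end SliceOperators

/-- The generalized Cauchy–Riemann operator `D_{𝐱_p} = ∑_{i=0}^p e_i ∂_{x_i}`
on slice functions. -/
def DP (F : Sl p → A) : Sl p → A :=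
  fun z => ∑ i, εp p q ξ i * pdSl p i F z

/-- The conjugated operator `D̄_{𝐱_p} = ∂_{x_0} - ∑_{i=1}^p e_i ∂_{x_i}`. -/
def DPbar (F : Sl p → A) : Sl p → A :=
  fun z => pdSl p 0 F z - ∑ i : Fin p, eP p q ξ i * pdSl p i.succ F z

/-- The generalized Cauchy–Riemann (Dirac) operator `D_𝐱` on `ℝ^{p+q+1}`. -/
def DV (f : V p q → A) : V p q → A :=
  fun z => ∑ i, εp p q ξ i * pdV1 p q i f z + ∑ j, eQ p q ξ j * pdV2 p q j f z

/-- `D_{𝐱_p} = ∑_{i=0}^p e_i ∂_{x_i}` on functions on `ℝ^{p+1}`. -/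
def DPfun (g : Vp p → A) : Vp p → A :=
  fun x => ∑ i, εp p q ξ i * pdP p i g x

/-- The slice operator `D_ω = D_{𝐱_p} + ω ∂_r`, expressed on `ℝ^{p+q+1} ∖ ℝ^{p+1}`
(at `𝐱_q = 0` the radial part is junk `0`). -/
def Dslice (f : V p q → A) : V p q → A :=
  fun z => ∑ i, εp p q ξ i * pdV1 p q i f z
    + ωCl p q ξ (‖z.2‖⁻¹ • z.2) * fderiv ℝ f z (0, ‖z.2‖⁻¹ • z.2)

/-- The spherical Dirac operator `Γ = -∑_{i<j} e_i e_j L_{ij}` on the `ℝ^q` variables. -/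
def sphericalDirac (f : V p q → A) : V p q → A :=
  fun z => - ∑ i : Fin q, ∑ j : Fin q,
    if (i : ℕ) < (j : ℕ) then
      eQ p q ξ i * eQ p q ξ j *
        (z.2 i • pdV2 p q j f z - z.2 j • pdV2 p q i f z)
    else 0

/-- `f` is left generalized partial-slice monogenic of type `(p,q)` on `Ω`. -/
def GSMOn (Ω : Set (V p q)) (f : V p q → A) : Prop :=
  ∀ v ∈ S q,
    ContDiffOn ℝ 1 (fun z => f (spt p q v z)) (sliceSet p q Ω v) ∧
    ∀ z ∈ sliceSet p q Ω v,
      DP p q ξ (fun w => f (spt p q v w)) z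
        + ωCl p q ξ v * pdr p (fun w => f (spt p q v w)) z = 0

/-- `f` is (left) monogenic on `Ω`. -/
def MonogenicOn (Ω : Set (V p q)) (f : V p q → A) : Prop :=
  ContDiffOn ℝ 1 f Ω ∧ ∀ z ∈ Ω, DV p q ξ f z = 0

/-- `f` is the generalized partial-slice function on `Ω_D` with components `F1, F2`
(an even–odd pair in the last variable). -/
def IsGPSlice (D : Set (Sl p)) (f : V p q → A) (F1 F2 : Sl p → A) : Prop :=
  (∀ z ∈ D, F1 (z.1, -z.2) = F1 z ∧ F2 (z.1, -z.2) = -F2 z) ∧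
  ∀ z ∈ D, ∀ v ∈ S q, f (spt p q v z) = F1 z + ωCl p q ξ v * F2 z

/-- The generalized Cauchy–Riemann system (2.6) for the pair `(F1, F2)`. -/
def CRSystem (D : Set (Sl p)) (F1 F2 : Sl p → A) : Prop :=
  ∀ z ∈ D, DP p q ξ F1 z - pdr p F2 z = 0 ∧ DPbar p q ξ F2 z + pdr p F1 z = 0

/-- `f ∈ 𝒢𝒮ℛ(Ω_D)` with the given components. -/
def GSROnWith (D : Set (Sl p)) (f : V p q → A) (F1 F2 : Sl p → A) : Prop :=
  IsGPSlice p q ξ D f F1 F2 ∧ ContDiffOn ℝ 1 F1 D ∧ ContDiffOn ℝ 1 F2 D ∧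
    CRSystem p q ξ D F1 F2

/-- `f ∈ 𝒢𝒮ℛ(Ω_D)`. -/
def GSROn (D : Set (Sl p)) (f : V p q → A) : Prop :=
  ∃ F1 F2, GSROnWith p q ξ D f F1 F2

/-- Iterates `((1/r) ∂_r)^k F`. -/
def AIter (F : Sl p → A) : ℕ → Sl p → A
  | 0 => F
  | k + 1 => fun z => z.2⁻¹ • pdr p (AIter F k) z

/-- Iterates `(∂_r (1/r))^k F`. -/
def BIter (F : Sl p → A) : ℕ → Sl p → A
  | 0 => F
  | k + 1 => fun z => fderiv ℝ (fun w : Sl p => w.2⁻¹ • BIter F k w) z (0, 1)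

/-- `C_q(k) = (q-1)(q-3)⋯(q-2k+1)`. -/
def Cq (k : ℕ) : ℝ := ∏ j ∈ Finset.range k, ((q : ℝ) - (2 * (j : ℝ) + 1))

/-- The Fueter–Sce map `τ_q = (1/(q-1)!!) Δ^{(q-1)/2}` (for odd `q`). -/
def tauq (f : V p q → A) : V p q → A :=
  fun z => (((q - 1)‼ : ℝ))⁻¹ • (LapV p q)^[(q - 1) / 2] f z

/-- `(𝐱_q D_{𝐱_p})^k`, for a fixed Clifford element `u` in place of `𝐱_q`. -/
def uDpow (u : A) : ℕ → (Vp p → A) → Vp p → A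
  | 0 => fun g => g
  | k + 1 => fun g x => u * DPfun p q ξ (uDpow u k g) x

/-- The `k`-th term of the slice Cauchy–Kovalevskaya extension series. -/
def ckTerm (f₀ : Vp p → A) (k : ℕ) (z : V p q) : A :=
  ((k ! : ℝ))⁻¹ • uDpow p q ξ (ωCl p q ξ z.2) k f₀ z.1

/-- The slice Cauchy–Kovalevskaya extension `CK[f₀]`. -/
def CKext (f₀ : Vp p → A) (z : V p q) : A := ∑' k, ckTerm p q ξ f₀ k z

/-- The `k`-th term of the CK-extension for a fixed direction `w`. -/
def ckDirTerm (w : Vq q) (f₀ : Vp p → A) (k : ℕ) (z : V p q) : A :=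
  ((⟪w, z.2⟫) ^ k / (k ! : ℝ)) • uDpow p q ξ (ωCl p q ξ w) k f₀ z.1

/-- The CK-extension for a fixed direction `w ∈ 𝕊`. -/
def CKdir (w : Vq q) (f₀ : Vp p → A) (z : V p q) : A :=
  ∑' k, ckDirTerm p q ξ w f₀ k z

/-- The coefficients of the generalized CK-extension:
`f_{2k} = (Γ(q/2) / (2^{2k} k! Γ(k+q/2))) Δ^k f₀` and
`f_{2k+1} = (Γ(q/2) / (2^{2k+1} k! Γ(k+q/2+1))) D Δ^k f₀`. -/
def gckCoeff (f₀ : Vp p → A) (k : ℕ) : Vp p → A :=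
  if k % 2 = 0 then
    fun x => (Real.Gamma ((q : ℝ) / 2) /
        (2 ^ k * ((k / 2)! : ℝ) * Real.Gamma (((k / 2 : ℕ) : ℝ) + (q : ℝ) / 2))) •
      (LapP p)^[k / 2] f₀ x
  else
    fun x => (Real.Gamma ((q : ℝ) / 2) /
        (2 ^ k * ((k / 2)! : ℝ) * Real.Gamma (((k / 2 : ℕ) : ℝ) + (q : ℝ) / 2 + 1))) •
      DPfun p q ξ ((LapP p)^[k / 2] f₀) x

/-- The `k`-th term `𝐱_q^k f_k(𝐱_p)` of the generalized CK-extension series. -/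
def gckTerm (f₀ : Vp p → A) (k : ℕ) (z : V p q) : A :=
  (ωCl p q ξ z.2) ^ k * gckCoeff p q ξ f₀ k z.1

/-- The generalized CK-extension `GCK[f₀]`. -/
def GCKext (f₀ : Vp p → A) (z : V p q) : A := ∑' k, gckTerm p q ξ f₀ k z

/-- The Radon transform `R[f](𝐱_p, r, ω) = ∫_{⟨𝐱_q,ω⟩=r} f(𝐱_p, 𝐱_q) dσ(𝐱_q)`. -/
def radon (f : V p q → A) (x : Vp p) (r : ℝ) (w : Vq q) : A :=
  ∫ u : ((Submodule.span ℝ {w})ᗮ : Submodule ℝ (Vq q)),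
    f (x, r • w + (u : Vq q))

/-- The (suitably normalized) surface measure on the unit sphere of `ℝ^q`. -/
def sphMeasure : Measure (sphere (0 : Vq q) 1) := volume.toSphere

/-- The dual Radon transform
`Ř[f](𝐱_p, 𝐱_q) = (1/A_q) ∫_𝕊 f(𝐱_p, ⟨𝐱_q, η⟩ η) dS(η)` (a spherical average). -/
def dualRadon (f : V p q → A) (z : V p q) : A :=
  ⨍ w : sphere (0 : Vq q) 1,
    f (z.1, (⟪((w : Vq q)), z.2⟫) • (w : Vq q)) ∂(sphMeasure q)

end GPS

open GPS

namespace GPS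

/-- The Clifford relations `e_i e_j + e_j e_i = -2δ_{ij}` for the generators inside `A`. -/
lemma gen_mul_add_swap (p q : ℕ) {A : Type*} [NormedRing A] [NormedAlgebra ℝ A]
    (ξ : A ≃ₐ[ℝ] Cl (p + q)) (i j : Fin (p + q)) :
    gen p q ξ i * gen p q ξ j + gen p q ξ j * gen p q ξ i = if i = j then -2 else 0 := by
  have h : e (p + q) i * e (p + q) j + e (p + q) j * e (p + q) i
      = algebraMap ℝ _ (if i = j then -2 else 0) := by
    unfold e
    rw [CliffordAlgebra.ι_mul_ι_add_swap]
    congr 1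
    simp only [QuadraticMap.polar, Qe, QuadraticMap.weightedSumSquares_apply, Pi.add_apply,
      smul_eq_mul, ← Finset.sum_sub_distrib]
    have : ∀ k : Fin (p + q), (-1 : ℝ) * (((Pi.single i 1 : Fin (p + q) → ℝ) k +
        (Pi.single j 1 : Fin (p + q) → ℝ) k) * ((Pi.single i 1 : Fin (p + q) → ℝ) k +
        (Pi.single j 1 : Fin (p + q) → ℝ) k)) - -1 * ((Pi.single i 1 : Fin (p + q) → ℝ) k *
        (Pi.single i 1 : Fin (p + q) → ℝ) k) - -1 * ((Pi.single j 1 : Fin (p + q) → ℝ) k *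
        (Pi.single j 1 : Fin (p + q) → ℝ) k)
        = if k = i then (if i = j then -2 else 0) else 0 := by
      intro k
      by_cases hk : k = i
      · subst hk
        by_cases hkj : k = j
        · subst hkj
          norm_num
        · simp [hkj]
      · simp [hk]
    simp only [this, Finset.sum_ite_eq', Finset.mem_univ, if_true]
  unfold gen
  rw [← map_mul, ← map_mul, ← map_add, h, AlgEquiv.commutes]
  split_ifs
  · rw [map_neg, map_ofNat]
  · rw [map_zero]

lemma eQ_mul_self (p q : ℕ) {A : Type*} [NormedRing A] [NormedAlgebra ℝ A]
    (ξ : A ≃ₐ[ℝ] Cl (p + q)) (j : Fin q) : eQ p q ξ j * eQ p q ξ j = -1 := by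
  have h := gen_mul_add_swap p q ξ ⟨p + j, by omega⟩ ⟨p + j, by omega⟩
  rw [if_pos rfl, ← two_smul ℝ] at h
  have h2 : (-2 : A) = (2 : ℝ) • (-1 : A) := by rw [two_smul]; norm_num
  rw [h2] at h
  exact smul_right_injective A (two_ne_zero' ℝ) h

lemma eP_mul_eQ (p q : ℕ) {A : Type*} [NormedRing A] [NormedAlgebra ℝ A]
    (ξ : A ≃ₐ[ℝ] Cl (p + q)) (i : Fin p) (j : Fin q) :
    eP p q ξ i * eQ p q ξ j = -(eQ p q ξ j * eP p q ξ i) := by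
  have h := gen_mul_add_swap p q ξ ⟨i, by omega⟩ ⟨p + j, by omega⟩
  rw [if_neg (by simp only [Fin.mk.injEq]; omega)] at h
  exact eq_neg_of_add_eq_zero_left h

lemma eP_mul_ωCl (p q : ℕ) {A : Type*} [NormedRing A] [NormedAlgebra ℝ A]
    (ξ : A ≃ₐ[ℝ] Cl (p + q)) (i : Fin p) (v : Vq q) :
    eP p q ξ i * ωCl p q ξ v = -(ωCl p q ξ v * eP p q ξ i) := by
  simp only [ωCl, Finset.mul_sum, Finset.sum_mul, mul_smul_comm, smul_mul_assoc, eP_mul_eQ,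
    smul_neg, Finset.sum_neg_distrib]

/-- Every `ω ∈ 𝕊` is an imaginary unit. -/
lemma ωCl_mul_self (p q : ℕ) {A : Type*} [NormedRing A] [NormedAlgebra ℝ A]
    (ξ : A ≃ₐ[ℝ] Cl (p + q)) {v : Vq q} (hv : v ∈ S q) :
    ωCl p q ξ v * ωCl p q ξ v = -1 := by
  have hv' : ∑ j, v j ^ 2 = 1 := hv
  have key : ωCl p q ξ v * ωCl p q ξ v + ωCl p q ξ v * ωCl p q ξ v = (2 : ℝ) • (-1 : A) := by
    calc ωCl p q ξ v * ωCl p q ξ v + ωCl p q ξ v * ωCl p q ξ v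
        = ∑ i, ∑ j, (v i * v j) • (eQ p q ξ i * eQ p q ξ j + eQ p q ξ j * eQ p q ξ i) := by
          simp only [smul_add, Finset.sum_add_distrib]
          congr 1
          · simp only [ωCl, Finset.sum_mul_sum, smul_mul_smul_comm]
          · rw [Finset.sum_comm]
            simp only [ωCl, Finset.sum_mul_sum, smul_mul_smul_comm, mul_comm]
      _ = ∑ i, ∑ j, if i = j then (v i ^ 2) • ((2 : ℝ) • (-1 : A)) else 0 := by
          refine Finset.sum_congr rfl fun i _ => Finset.sum_congr rfl fun j _ => ?_
          have h := gen_mul_add_swap p q ξ ⟨p + i, by omega⟩ ⟨p + j, by omega⟩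
          unfold eQ
          rw [h]
          by_cases hij : i = j
          · subst hij
            rw [if_pos rfl, if_pos rfl, sq, two_smul]
            norm_num
          · rw [if_neg hij, if_neg, smul_zero]
            simp only [Fin.mk.injEq]
            omega
      _ = (2 : ℝ) • (-1 : A) := by
          simp only [Finset.sum_ite_eq, Finset.mem_univ, if_true]
          rw [← Finset.sum_smul, hv', one_smul]
  rw [← two_smul ℝ] at key
  exact smul_right_injective A (two_ne_zero' ℝ) key

lemma norm_eq_one_of_mem_S {q : ℕ} {v : Vq q} (hv : v ∈ S q) : ‖v‖ = 1 := by
  have hv' : ∑ j, v j ^ 2 = 1 := hv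
  rw [EuclideanSpace.norm_eq]
  simp [hv']

lemma mem_S_of_norm_eq_one {q : ℕ} {v : Vq q} (hv : ‖v‖ = 1) : v ∈ S q := by
  have h := EuclideanSpace.norm_sq_eq v
  rw [hv] at h
  change ∑ j, v j ^ 2 = 1
  simpa using h.symm

lemma S_nonempty {q : ℕ} (hq : 1 ≤ q) : (S q).Nonempty :=
  ⟨EuclideanSpace.single ⟨0, hq⟩ 1, mem_S_of_norm_eq_one (by simp)⟩

/-- The map `𝐱_q ↦ ∑ x_i e_{p+i}` as a continuous linear map. -/
def ωCLM (p q : ℕ) {A : Type*} [NormedRing A] [NormedAlgebra ℝ A]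
    (ξ : A ≃ₐ[ℝ] Cl (p + q)) : Vq q →L[ℝ] A :=
  ∑ j, (EuclideanSpace.proj j : Vq q →L[ℝ] ℝ).smulRight (eQ p q ξ j)

lemma ωCLM_apply (p q : ℕ) {A : Type*} [NormedRing A] [NormedAlgebra ℝ A]
    (ξ : A ≃ₐ[ℝ] Cl (p + q)) (v : Vq q) : ωCLM p q ξ v = ωCl p q ξ v := by
  simp [ωCLM, ωCl]

lemma ωCl_smul (p q : ℕ) {A : Type*} [NormedRing A] [NormedAlgebra ℝ A]
    (ξ : A ≃ₐ[ℝ] Cl (p + q)) (c : ℝ) (v : Vq q) :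
    ωCl p q ξ (c • v) = c • ωCl p q ξ v := by
  simp only [← ωCLM_apply, map_smul]

lemma ωCl_single (p q : ℕ) {A : Type*} [NormedRing A] [NormedAlgebra ℝ A]
    (ξ : A ≃ₐ[ℝ] Cl (p + q)) (j : Fin q) :
    ωCl p q ξ (EuclideanSpace.single j 1) = eQ p q ξ j := by
  simp [ωCl, ite_smul]

lemma mem_completion_iff {p q : ℕ} (hq : 1 ≤ q) {D : Set (Sl p)} (hrefl : ReflInv p D)
    (x : V p q) : x ∈ completion p q D ↔ ((x.1, ‖x.2‖) : Sl p) ∈ D := by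
  constructor
  · rintro ⟨z, hz, v, hv, rfl⟩
    simp only [spt, norm_smul, norm_eq_one_of_mem_S hv, mul_one, Real.norm_eq_abs]
    rcases abs_choice z.2 with h | h <;> rw [h]
    · exact hz
    · exact hrefl z hz
  · intro h
    by_cases h0 : x.2 = 0
    · obtain ⟨v, hv⟩ := S_nonempty hq
      refine ⟨_, h, v, hv, ?_⟩
      ext1 <;> simp [spt, h0]
    · refine ⟨_, h, ‖x.2‖⁻¹ • x.2, mem_S_of_norm_eq_one (norm_smul_inv_norm h0), ?_⟩
      have : ‖x.2‖ ≠ 0 := norm_ne_zero_iff.mpr h0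
      ext1 <;> simp [spt, smul_smul, this]

lemma isOpen_completion {p q : ℕ} (hq : 1 ≤ q) {D : Set (Sl p)} (hD : IsOpen D)
    (hrefl : ReflInv p D) : IsOpen (completion p q D) := by
  have : completion p q D = (fun x : V p q => ((x.1, ‖x.2‖) : Sl p)) ⁻¹' D := by
    ext x
    exact mem_completion_iff hq hrefl x
  rw [this]
  exact hD.preimage (by fun_prop)

/-- The derivative of a generalized partial-slice function off `ℝ^{p+1}`. -/
lemma IsGPSlice.fderiv_apply {p q : ℕ} {A : Type*} [NormedRing A] [NormedAlgebra ℝ A]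
    {ξ : A ≃ₐ[ℝ] Cl (p + q)} {D : Set (Sl p)} (hD : IsOpen D)
    {f : V p q → A} {F1 F2 : Sl p → A} (hgs : IsGPSlice p q ξ D f F1 F2)
    {z : Sl p} (hz : z ∈ D) (hr : z.2 ≠ 0)
    (hF1 : DifferentiableAt ℝ F1 z) (hF2 : DifferentiableAt ℝ F2 z)
    {v : Vq q} (hv : v ∈ S q) (a : Vp p) (h : Vq q) :
    fderiv ℝ f (spt p q v z) (a, h) = fderiv ℝ F1 z (a, ⟪v, h⟫)
      + (ωCl p q ξ v * fderiv ℝ F2 z (a, ⟪v, h⟫)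
        + (z.2⁻¹ • ωCl p q ξ h - (z.2⁻¹ * ⟪v, h⟫) • ωCl p q ξ v) * F2 z) := by
  obtain ⟨x, r⟩ := z
  simp only at hr ⊢
  have hvn := norm_eq_one_of_mem_S hv
  obtain ⟨s, hs, hsr⟩ : ∃ s : ℝ, s * s = 1 ∧ s * |r| = r := by
    rcases lt_or_gt_of_ne hr with h | h
    · exact ⟨-1, by norm_num, by rw [abs_of_neg h]; ring⟩
    · exact ⟨1, by norm_num, by rw [abs_of_pos h]; ring⟩
  have hs0 : s ≠ 0 := by rintro rfl; norm_num at hs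
  have hv0 : v ≠ 0 := by rintro rfl; norm_num at hvn
  have hy0 : r • v ≠ 0 := smul_ne_zero hr hv0
  have hny : s * ‖r • v‖ = r := by rw [norm_smul, hvn, mul_one, Real.norm_eq_abs, hsr]
  have hρ : HasFDerivAt (fun y : Vq q => s * ‖y‖) (innerSL ℝ v) (r • v) := by
    have h1 := ((hasStrictFDerivAt_norm_sq (r • v)).hasFDerivAt.sqrt
      (by positivity)).const_mul s
    simp only [Real.sqrt_sq (norm_nonneg _)] at h1
    refine h1.congr_fderiv ?_
    ext k
    have : ‖r • v‖ = s * r := by linear_combination s * hny - ‖r • v‖ * hs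
    simp [this]
    field_simp
  have hproj : HasFDerivAt (fun w : V p q => s * ‖w.2‖)
      ((innerSL ℝ v).comp (ContinuousLinearMap.snd ℝ (Vp p) (Vq q))) (x, r • v) :=
    HasFDerivAt.comp (x, r • v) (f := Prod.snd) hρ hasFDerivAt_snd
  set L : V p q →L[ℝ] Sl p := (ContinuousLinearMap.fst ℝ (Vp p) (Vq q)).prod
    ((innerSL ℝ v).comp (ContinuousLinearMap.snd ℝ (Vp p) (Vq q))) with hL
  have hπ : HasFDerivAt (fun w : V p q => ((w.1, s * ‖w.2‖) : Sl p)) L (x, r • v) :=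
    hasFDerivAt_fst.prodMk hproj
  have hc (F : Sl p → A) (hF : DifferentiableAt ℝ F (x, r)) :
      HasFDerivAt (fun w : V p q => F (w.1, s * ‖w.2‖)) ((fderiv ℝ F (x, r)).comp L)
        (x, r • v) := by
    refine HasFDerivAt.comp (x, r • v) (f := fun w : V p q => ((w.1, s * ‖w.2‖) : Sl p)) ?_ hπ
    simpa only [hny] using hF.hasFDerivAt
  have hω : HasFDerivAt (fun w : V p q => ωCLM p q ξ w.2)
      ((ωCLM p q ξ).comp (ContinuousLinearMap.snd ℝ (Vp p) (Vq q))) (x, r • v) :=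
    ((ωCLM p q ξ).comp (ContinuousLinearMap.snd ℝ (Vp p) (Vq q))).hasFDerivAt
  have hinv := (hasDerivAt_inv (x := s * ‖r • v‖) (by rw [hny]; exact hr)).comp_hasFDerivAt
    (x, r • v) (f := fun w : V p q => s * ‖w.2‖) hproj
  have hg := (hc F1 hF1).add ((hinv.smul hω).mul' (hc F2 hF2))
  have hev : f =ᶠ[𝓝 (x, r • v)] fun w : V p q => F1 (w.1, s * ‖w.2‖) +
      ((s * ‖w.2‖)⁻¹ • ωCLM p q ξ w.2) * F2 (w.1, s * ‖w.2‖) := by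
    have hmem : ∀ᶠ w : V p q in 𝓝 (x, r • v), ((w.1, s * ‖w.2‖) : Sl p) ∈ D :=
      hπ.continuousAt.eventually_mem (by simpa only [hny] using hD.mem_nhds hz)
    have hne : ∀ᶠ w : V p q in 𝓝 (x, r • v), w.2 ≠ 0 :=
      continuousAt_snd.eventually_ne hy0
    filter_upwards [hmem, hne] with w hw hw0
    have hnw : ‖w.2‖ ≠ 0 := norm_ne_zero_iff.mpr hw0
    have hu : (s * ‖w.2‖)⁻¹ • w.2 ∈ S q := by
      refine mem_S_of_norm_eq_one ?_
      have : |s| = 1 := by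
        rcases mul_self_eq_one_iff.mp hs with h | h <;> simp [h]
      simp [norm_smul, this, hnw]
    have := hgs.2 _ hw _ hu
    rw [ωCl_smul, ← ωCLM_apply] at this
    rw [← this]
    congr 1
    ext1
    · rfl
    · simp only [spt]
      rw [smul_inv_smul₀ (mul_ne_zero hs0 hnw)]
  have hfd := (hg.congr_of_eventuallyEq hev).fderiv
  change fderiv ℝ f (x, r • v) (a, h) = _
  rw [hfd]
  simp [hL, hny, ωCLM_apply, ωCl_smul, smul_smul, hr]
  have hc2 : (r ^ 2)⁻¹ * ⟪v, h⟫ * r = r⁻¹ * ⟪v, h⟫ := by field_simp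
  rw [hc2, sub_mul, smul_mul_assoc, smul_mul_assoc, sub_eq_add_neg]

lemma IsGPSlice.DV_eq {p q : ℕ} {A : Type*} [NormedRing A] [NormedAlgebra ℝ A]
    {ξ : A ≃ₐ[ℝ] Cl (p + q)} {D : Set (Sl p)} (hD : IsOpen D)
    {f : V p q → A} {F1 F2 : Sl p → A} (hgs : IsGPSlice p q ξ D f F1 F2)
    {z : Sl p} (hz : z ∈ D) (hr : z.2 ≠ 0)
    (hF1 : DifferentiableAt ℝ F1 z) (hF2 : DifferentiableAt ℝ F2 z)
    {v : Vq q} (hv : v ∈ S q) :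
    DV p q ξ f (spt p q v z) =
      (DP p q ξ F1 z - pdr p F2 z - (((q : ℝ) - 1) / z.2) • F2 z)
        + ωCl p q ξ v * (DPbar p q ξ F2 z + pdr p F1 z) := by
  have hω := ωCl_mul_self p q ξ hv
  have h1 (i : Fin (p + 1)) : pdV1 p q i f (spt p q v z) =
      pdSl p i F1 z + ωCl p q ξ v * pdSl p i F2 z := by
    unfold pdV1 pdSl
    rw [hgs.fderiv_apply hD hz hr hF1 hF2 hv]
    have h0 : ωCl p q ξ 0 = 0 := by simp [ωCl]
    simp [h0]
  have hlin (F : Sl p → A) (c : ℝ) : fderiv ℝ F z (0, c) = c • pdr p F z := by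
    unfold pdr
    rw [← map_smul]
    simp
  have h2 (j : Fin q) : pdV2 p q j f (spt p q v z) =
      v j • (pdr p F1 z + ωCl p q ξ v * pdr p F2 z - z.2⁻¹ • (ωCl p q ξ v * F2 z))
        + z.2⁻¹ • (eQ p q ξ j * F2 z) := by
    unfold pdV2
    rw [hgs.fderiv_apply hD hz hr hF1 hF2 hv, ωCl_single, hlin, hlin]
    have : (⟪v, EuclideanSpace.single j 1⟫ : ℝ) = v j := by
      simp [EuclideanSpace.inner_single_right]
    rw [this]
    simp only [sub_mul, smul_mul_assoc, mul_smul_comm, smul_add, smul_sub, smul_smul,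
      mul_comm z.2⁻¹]
    abel
  have hP : ∑ i, εp p q ξ i * (ωCl p q ξ v * pdSl p i F2 z) =
      ωCl p q ξ v * DPbar p q ξ F2 z := by
    rw [Fin.sum_univ_succ, DPbar, mul_sub, sub_eq_add_neg, Finset.mul_sum,
      ← Finset.sum_neg_distrib]
    congr 1
    · simp [εp]
    · refine Finset.sum_congr rfl fun i _ => ?_
      change eP p q ξ i * _ = _
      rw [← mul_assoc, eP_mul_ωCl, neg_mul, mul_assoc]
  have hQ (c : A) : ∑ j, eQ p q ξ j * (v j • c) = ωCl p q ξ v * c := by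
    simp only [ωCl, Finset.sum_mul, mul_smul_comm, smul_mul_assoc]
  have hQ' : ∑ j, eQ p q ξ j * (z.2⁻¹ • (eQ p q ξ j * F2 z)) = -((q / z.2) • F2 z) := by
    simp only [mul_smul_comm, ← mul_assoc, eQ_mul_self, neg_mul, one_mul, smul_neg,
      Finset.sum_neg_distrib, Finset.sum_const, Finset.card_univ, Fintype.card_fin,
      ← Nat.cast_smul_eq_nsmul ℝ, smul_smul, div_eq_mul_inv]
  unfold DV
  simp only [h1, h2, mul_add, Finset.sum_add_distrib, hP]
  rw [hQ, hQ']
  have hc : ((q : ℝ) - 1) / z.2 = q / z.2 - z.2⁻¹ := by rw [sub_div, one_div]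
  rw [mul_sub, mul_add, mul_smul_comm, ← mul_assoc, ← mul_assoc, hω, hc, sub_smul, neg_one_mul,
    neg_one_mul, smul_neg]
  unfold DP
  abel

end GPS

/-- **Vekua-type characterization** (Lemma 3.2).  For
`f = F₁ + ωF₂ ∈ 𝒢𝒮¹(Ω_D) ∩ C¹(Ω_D)`, `f` is monogenic on `Ω_D` if and only if
`D_{𝐱_p}F₁ − ∂_r F₂ = ((q−1)/r) F₂` and `D̄_{𝐱_p}F₂ + ∂_r F₁ = 0` on `D ∖ ℝ^{p+1}`. -/
theorem vekua_characterization
    (p q : ℕ) (hq : 1 ≤ q) {A : Type*} [NormedRing A] [NormedAlgebra ℝ A]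
    (ξ : A ≃ₐ[ℝ] Cl (p + q))
    (D : Set (Sl p)) (hD : IsDomain D) (hrefl : ReflInv p D)
    (f : V p q → A) (F1 F2 : Sl p → A)
    (hgs : IsGPSlice p q ξ D f F1 F2)
    (hF1 : ContDiffOn ℝ 1 F1 D) (hF2 : ContDiffOn ℝ 1 F2 D)
    (hf : ContDiffOn ℝ 1 f (completion p q D)) :
    MonogenicOn p q ξ (completion p q D) f ↔
      ∀ z ∈ D, z.2 ≠ 0 →
        DP p q ξ F1 z - pdr p F2 z = (((q : ℝ) - 1) / z.2) • F2 z ∧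
        DPbar p q ξ F2 z + pdr p F1 z = 0 := by
  have hD' := hD.1
  have hΩ := isOpen_completion hq hD' hrefl
  have hDV {z : Sl p} (hz : z ∈ D) (hr : z.2 ≠ 0) {v : Vq q} (hv : v ∈ S q) :=
    hgs.DV_eq hD' hz hr ((hF1.differentiableOn one_ne_zero).differentiableAt (hD'.mem_nhds hz))
      ((hF2.differentiableOn one_ne_zero).differentiableAt (hD'.mem_nhds hz)) hv
  constructor
  · rintro ⟨-, hmon⟩ z hz hr
    obtain ⟨v, hv⟩ := S_nonempty hq
    have hv' : -v ∈ S q := mem_S_of_norm_eq_one (by rw [norm_neg, norm_eq_one_of_mem_S hv])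
    have h1 := (hDV hz hr hv).symm.trans (hmon _ ⟨z, hz, v, hv, rfl⟩)
    have h2 := (hDV hz hr hv').symm.trans (hmon _ ⟨z, hz, -v, hv', rfl⟩)
    rw [← neg_one_smul ℝ v, ωCl_smul, neg_one_smul, neg_mul, ← sub_eq_add_neg] at h2
    have h3 := sub_eq_zero.mp h2
    rw [← h3, ← two_smul ℝ] at h1
    have h4 := (smul_eq_zero.mp h1).resolve_left two_ne_zero
    refine ⟨sub_eq_zero.mp h4, ?_⟩
    rw [h4] at h3
    have h5 := congrArg (ωCl p q ξ v * ·) h3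
    simpa only [← mul_assoc, ωCl_mul_self p q ξ hv, mul_zero, neg_one_mul, zero_eq_neg] using h5
  · intro hsys
    refine ⟨hf, ?_⟩
    have hzero {z : Sl p} (hz : z ∈ D) (hr : z.2 ≠ 0) {v : Vq q} (hv : v ∈ S q) :
        DV p q ξ f (spt p q v z) = 0 := by
      obtain ⟨h1, h2⟩ := hsys z hz hr
      rw [hDV hz hr hv, h1, h2, sub_self, mul_zero, add_zero]
    rintro _ ⟨z, hz, v, hv, rfl⟩
    have hcont : ContinuousAt (DV p q ξ f) (spt p q v z) := by
      have hfd : ContinuousAt (fderiv ℝ f) (spt p q v z) :=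
        (hf.continuousOn_fderiv_of_isOpen hΩ le_rfl).continuousAt
          (hΩ.mem_nhds ⟨z, hz, v, hv, rfl⟩)
      unfold DV pdV1 pdV2
      fun_prop
    have hpath : Continuous fun t : ℝ => ((z.1, t) : Sl p) := by fun_prop
    have hspt : Continuous fun t : ℝ => spt p q v (z.1, t) := by unfold spt; fun_prop
    have hlim : Tendsto (fun t : ℝ => DV p q ξ f (spt p q v (z.1, t))) (𝓝[≠] z.2)
        (𝓝 (DV p q ξ f (spt p q v z))) :=
      (ContinuousAt.comp (f := fun t : ℝ => spt p q v (z.1, t)) hcont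
        hspt.continuousAt).tendsto.mono_left nhdsWithin_le_nhds
    refine tendsto_nhds_unique hlim (tendsto_const_nhds.congr' ?_)
    have hmem : ∀ᶠ t in 𝓝 z.2, ((z.1, t) : Sl p) ∈ D :=
      hpath.continuousAt.eventually_mem (hD'.mem_nhds hz)
    have hne : ∀ᶠ t in 𝓝[≠] z.2, t ≠ 0 := by
      by_cases h0 : z.2 = 0
      · rw [h0]
        exact self_mem_nhdsWithin
      · exact nhdsWithin_le_nhds (eventually_ne_nhds h0)
    filter_upwards [nhdsWithin_le_nhds hmem, hne] with t ht ht0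
    exact (hzero ht ht0 hv).symm
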